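/- Weak quantum substate property from observational divergence: Let ρ and σ be quantum states on ℂ^n with supp(ρ) ⊆ supp(σ), and let k := D(ρ‖σ). Set k' := k + 4·√(k+1) + 2·logb 2 (k+1) + 4. Then for every real r ≥ 1 there exists a quantum state ρ' on ℂ^n such that ‖ρ − ρ'‖₁ ≤ 2/√r and the matrix σ − ((r−1)/(r·2^{r·k'}))·ρ' is positive semidefinite. -/

import Mathlib

open Matrix BigOperators
open scoped ComplexOrder

noncomputable section

/-- A quantum state: positive semidefinite matrix with unit trace. -/
def IsState {d : Type*} [Fintype d] (ρ : Matrix d d ℂ) : Prop :=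
  ρ.PosSemidef ∧ ρ.trace = 1

/-- `SuppLE ρ σ` : the support of `ρ` is contained in the support of `σ`,
expressed as inclusion of kernels the other way. -/
def SuppLE {d : Type*} [Fintype d] (ρ σ : Matrix d d ℂ) : Prop :=
  ∀ v : d → ℂ, σ *ᵥ v = 0 → ρ *ᵥ v = 0

/-- Matrix logarithm: apply `Real.log` to the eigenvalues (with `log 0 = 0`). -/
noncomputable def matLog {d : Type*} [Fintype d] [DecidableEq d]
    (ρ : Matrix d d ℂ) : Matrix d d ℂ :=
  if h : ρ.IsHermitian then
    (h.eigenvectorUnitary : Matrix d d ℂ) *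
      Matrix.diagonal (fun i => (Real.log (h.eigenvalues i) : ℂ)) *
      (star (h.eigenvectorUnitary : Matrix d d ℂ))
  else 0

/-- Quantum relative entropy `S(ρ‖σ) = Re Tr (ρ (log ρ - log σ))`. -/
noncomputable def relEnt {d : Type*} [Fintype d] [DecidableEq d]
    (ρ σ : Matrix d d ℂ) : ℝ :=
  (Matrix.trace (ρ * (matLog ρ - matLog σ))).re

/-- Trace norm of a Hermitian matrix: sum of absolute values of eigenvalues. -/
noncomputable def traceNorm {d : Type*} [Fintype d] [DecidableEq d]
    (A : Matrix d d ℂ) : ℝ :=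
  if h : A.IsHermitian then ∑ i, |h.eigenvalues i| else 0

/-- Rank-one operator `|ψ⟩⟨ψ|`. -/
def ketbra {d : Type*} (ψ : d → ℂ) : Matrix d d ℂ :=
  Matrix.of fun a b => ψ a * (starRingEnd ℂ) (ψ b)

/-- A POVM element: a positive semidefinite matrix `F` with `1 - F` positive semidefinite. -/
def IsPOVMElem {d : Type*} [Fintype d] [DecidableEq d] (F : Matrix d d ℂ) : Prop :=
  F.PosSemidef ∧ ((1 : Matrix d d ℂ) - F).PosSemidef

/-- `trR F ρ = Re Tr (F ρ)`. -/
noncomputable def trR {d : Type*} [Fintype d] (F ρ : Matrix d d ℂ) : ℝ :=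
  (Matrix.trace (F * ρ)).re

/-- Observational divergence `D(ρ‖σ)`. -/
noncomputable def obsDiv {d : Type*} [Fintype d] [DecidableEq d]
    (ρ σ : Matrix d d ℂ) : ℝ :=
  sSup {x : ℝ | ∃ F : Matrix d d ℂ, IsPOVMElem F ∧ trR F σ ≠ 0 ∧
    x = trR F ρ * Real.logb 2 (trR F ρ / trR F σ)}

/-- A probability distribution on `Fin n`. -/
def IsProbDist {n : ℕ} (P : Fin n → ℝ) : Prop :=
  (∀ i, 0 ≤ P i) ∧ ∑ i, P i = 1

/-- Classical relative entropy (base 2); terms with `P i = 0` contribute `0`. -/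
noncomputable def cRelEnt {n : ℕ} (P Q : Fin n → ℝ) : ℝ :=
  ∑ i, P i * Real.logb 2 (P i / Q i)

/-- Classical observational divergence. -/
noncomputable def cObsDiv {n : ℕ} (P Q : Fin n → ℝ) : ℝ :=
  sSup {x : ℝ | ∃ f : Fin n → ℝ, (∀ i, 0 ≤ f i ∧ f i ≤ 1) ∧
    (∑ i, f i * Q i) ≠ 0 ∧
    x = (∑ i, f i * P i) * Real.logb 2 ((∑ i, f i * P i) / (∑ i, f i * Q i))}


section Helpers

variable {n : ℕ}

/-- functional calculus through the eigen-decomposition -/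
def fcal {A : Matrix (Fin n) (Fin n) ℂ} (h : A.IsHermitian) (g : ℝ → ℝ) : Matrix (Fin n) (Fin n) ℂ :=
  (h.eigenvectorUnitary : Matrix (Fin n) (Fin n) ℂ) * Matrix.diagonal (fun i => ((g (h.eigenvalues i) : ℝ) : ℂ)) *
    star (h.eigenvectorUnitary : Matrix (Fin n) (Fin n) ℂ)

lemma fcal_id {A : Matrix (Fin n) (Fin n) ℂ} (h : A.IsHermitian) : fcal h (fun x => x) = A := by
  conv_rhs => rw [h.spectral_theorem, Unitary.conjStarAlgAut_apply]
  rfl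

lemma fcal_one {A : Matrix (Fin n) (Fin n) ℂ} (h : A.IsHermitian) : fcal h (fun _ => 1) = 1 := by
  simp [fcal]

lemma fcal_add {A : Matrix (Fin n) (Fin n) ℂ} (h : A.IsHermitian) (f g : ℝ → ℝ) :
    fcal h (fun x => f x + g x) = fcal h f + fcal h g := by
  unfold fcal
  rw [← add_mul, ← mul_add, Matrix.diagonal_add]
  simp

lemma fcal_sub {A : Matrix (Fin n) (Fin n) ℂ} (h : A.IsHermitian) (f g : ℝ → ℝ) :
    fcal h (fun x => f x - g x) = fcal h f - fcal h g := by
  unfold fcal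
  rw [← sub_mul, ← mul_sub, Matrix.diagonal_sub]
  simp

lemma fcal_smul {A : Matrix (Fin n) (Fin n) ℂ} (h : A.IsHermitian) (c : ℝ) (g : ℝ → ℝ) :
    fcal h (fun x => c * g x) = (c : ℂ) • fcal h g := by
  unfold fcal
  rw [← smul_mul_assoc, ← mul_smul_comm, ← Matrix.diagonal_smul]
  congr 3
  ext i
  simp

lemma fcal_mul {A : Matrix (Fin n) (Fin n) ℂ} (h : A.IsHermitian) (f g : ℝ → ℝ) :
    fcal h (fun x => f x * g x) = fcal h f * fcal h g := by
  unfold fcal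
  have : star (h.eigenvectorUnitary : Matrix (Fin n) (Fin n) ℂ) * (h.eigenvectorUnitary : Matrix (Fin n) (Fin n) ℂ) = 1 := by simp
  have e : ∀ U D E V : Matrix (Fin n) (Fin n) ℂ, V * U = 1 → (U * D * V) * (U * E * V) = U * (D * E) * V := by
    intro U D E V hh
    calc (U * D * V) * (U * E * V) = U * D * (V * U) * E * V := by noncomm_ring
      _ = _ := by rw [hh]; noncomm_ring
  rw [e _ _ _ _ this, Matrix.diagonal_mul_diagonal]
  simp

lemma fcal_mul_self {A : Matrix (Fin n) (Fin n) ℂ} (h : A.IsHermitian) (f : ℝ → ℝ) :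
    fcal h (fun x => f x * x) = fcal h f * A := by
  rw [fcal_mul, fcal_id]

lemma fcal_psd {A : Matrix (Fin n) (Fin n) ℂ} (h : A.IsHermitian) (g : ℝ → ℝ)
    (hg : ∀ i, 0 ≤ g (h.eigenvalues i)) : (fcal h g).PosSemidef := by
  unfold fcal
  rw [Matrix.star_eq_conjTranspose]
  apply Matrix.PosSemidef.mul_mul_conjTranspose_same
  apply Matrix.PosSemidef.diagonal
  intro i
  simpa using hg i

lemma fcal_trace {A : Matrix (Fin n) (Fin n) ℂ} (h : A.IsHermitian) (g : ℝ → ℝ) :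
    ((fcal h g).trace).re = ∑ i, g (h.eigenvalues i) := by
  unfold fcal
  rw [Matrix.trace_mul_comm, ← mul_assoc]
  simp [Matrix.trace_diagonal]

lemma trR_comm (A B : Matrix (Fin n) (Fin n) ℂ) : trR A B = trR B A := by
  unfold trR; rw [Matrix.trace_mul_comm]

lemma trR_sub_right (F A B : Matrix (Fin n) (Fin n) ℂ) : trR F (A - B) = trR F A - trR F B := by
  simp [trR, mul_sub]

lemma trR_add_right (F A B : Matrix (Fin n) (Fin n) ℂ) : trR F (A + B) = trR F A + trR F B := by
  simp [trR, mul_add]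

lemma trR_smul_right (F A : Matrix (Fin n) (Fin n) ℂ) (c : ℝ) : trR F ((c : ℂ) • A) = c * trR F A := by
  simp [trR]

lemma trR_sub_left (F A B : Matrix (Fin n) (Fin n) ℂ) : trR (A - B) F = trR A F - trR B F := by
  simp [trR, sub_mul]

lemma trR_smul_left (F A : Matrix (Fin n) (Fin n) ℂ) (c : ℝ) : trR ((c : ℂ) • A) F = c * trR A F := by
  simp [trR]

lemma trR_nonneg {A B : Matrix (Fin n) (Fin n) ℂ} (hA : A.PosSemidef) (hB : B.PosSemidef) : 0 ≤ trR A B := by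
  have hs : fcal hA.1 Real.sqrt * fcal hA.1 Real.sqrt = A := by
    rw [← fcal_mul]
    conv_rhs => rw [← fcal_id hA.1]
    unfold fcal
    congr 3
    ext i
    exact congrArg _ (Real.mul_self_sqrt (hA.eigenvalues_nonneg i))
  have hp := fcal_psd hA.1 Real.sqrt (fun i => Real.sqrt_nonneg _)
  unfold trR
  rw [← hs, mul_assoc, Matrix.trace_mul_comm]
  have := (hB.mul_mul_conjTranspose_same (fcal hA.1 Real.sqrt)).trace_nonneg
  rw [hp.1] at this
  exact (Complex.le_def.1 this).1

lemma trR_mono_left {A B F : Matrix (Fin n) (Fin n) ℂ} (h : (B - A).PosSemidef) (hF : F.PosSemidef) :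
    trR A F ≤ trR B F := by
  have := trR_nonneg h hF
  rw [trR_sub_left] at this
  linarith

lemma trR_one (A : Matrix (Fin n) (Fin n) ℂ) : trR 1 A = A.trace.re := by simp [trR]

lemma state_le_one {ρ : Matrix (Fin n) (Fin n) ℂ} (hρ : IsState ρ) : (1 - ρ).PosSemidef := by
  have h := fcal_psd hρ.1.1 (fun x => 1 - x) (by
    intro i
    have h1 := fcal_trace hρ.1.1 (fun x => x)
    rw [fcal_id] at h1
    have h2 : ρ.trace.re = 1 := by rw [hρ.2]; simp
    have := Finset.single_le_sum (fun j _ => hρ.1.eigenvalues_nonneg j) (Finset.mem_univ i)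
    linarith)
  rwa [fcal_sub, fcal_one, fcal_id] at h

lemma dominate {ρ σ : Matrix (Fin n) (Fin n) ℂ} (hρ : IsState ρ) (hσ : IsState σ) (hs : SuppLE ρ σ) :
    ∃ C : ℝ, 0 < C ∧ ∀ F : Matrix (Fin n) (Fin n) ℂ, F.PosSemidef → trR F ρ ≤ C * trR F σ := by
  set h := hσ.1.1
  have hnn := hσ.1.eigenvalues_nonneg
  set C : ℝ := 1 + ∑ i, (h.eigenvalues i)⁻¹ with hC
  have hCi : ∀ i, (h.eigenvalues i)⁻¹ ≤ C := by
    intro i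
    have := Finset.single_le_sum (f := fun j => (h.eigenvalues j)⁻¹)
      (fun j _ => inv_nonneg.2 (hnn j)) (Finset.mem_univ i)
    linarith
  have hC0 : 0 < C := by
    have : 0 ≤ ∑ i, (h.eigenvalues i)⁻¹ := Finset.sum_nonneg (fun j _ => inv_nonneg.2 (hnn j))
    linarith
  refine ⟨C, hC0, fun F hF => ?_⟩
  set Pi := fcal h (fun x => if x = 0 then 0 else 1) with hPi
  set Z := fcal h (fun x => if x = 0 then 1 else 0) with hZ
  have hPZ : Pi + Z = 1 := by
    rw [hPi, hZ, ← fcal_add, ← fcal_one h]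
    congr 1; ext x; split_ifs <;> simp
  have hPP : Pi * Pi = Pi := by
    rw [hPi, ← fcal_mul]
    congr 1; ext x; split_ifs <;> simp
  have hPpsd : Pi.PosSemidef := fcal_psd h _ (by intro i; split_ifs <;> simp)
  have hsZ : σ * Z = 0 := by
    conv_lhs => rw [← fcal_id h]
    rw [hZ, ← fcal_mul]
    have : (fun x : ℝ => x * (if x = 0 then (1:ℝ) else 0)) = fun x => (0:ℝ) * 1 := by
      ext x; split_ifs with hx <;> simp [hx]
    rw [this, fcal_smul]; simp
  have hrZ : ρ * Z = 0 := by
    apply Matrix.ext_of_mulVec_single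
    intro j
    rw [← Matrix.mulVec_mulVec, Matrix.zero_mulVec]
    apply hs
    rw [Matrix.mulVec_mulVec, hsZ, Matrix.zero_mulVec]
  have hrP : ρ * Pi = ρ := by
    calc ρ * Pi = ρ * (Pi + Z) - ρ * Z := by noncomm_ring
      _ = ρ := by rw [hPZ, hrZ]; simp
  have hPr : Pi * ρ = ρ := by
    have := congrArg Matrix.conjTranspose hrP
    rwa [Matrix.conjTranspose_mul, hPpsd.1, hρ.1.1] at this
  have e1 : trR F ρ = trR (Pi * F * Pi) ρ := by
    unfold trR
    rw [mul_assoc (Pi * F), hPr, mul_assoc, Matrix.trace_mul_comm Pi, mul_assoc, hrP]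
  have hPFP : (Pi * F * Pi).PosSemidef := by
    have := hF.mul_mul_conjTranspose_same Pi
    rwa [hPpsd.1] at this
  have e2 : trR (Pi * F * Pi) ρ ≤ trR (Pi * F * Pi) 1 := by
    rw [trR_comm, trR_comm _ 1]
    exact trR_mono_left (state_le_one hρ) hPFP
  have e3 : trR (Pi * F * Pi) 1 = trR Pi F := by
    unfold trR
    rw [mul_one, Matrix.trace_mul_comm, ← mul_assoc, hPP]
  have e4 : trR Pi F ≤ trR ((C : ℂ) • σ) F := by
    apply trR_mono_left _ hF
    have := fcal_psd h (fun x => C * x - if x = 0 then 0 else 1) (by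
      intro i
      split_ifs with hx
      · rw [hx]; simp
      · have := mul_le_mul_of_nonneg_right (hCi i) (hnn i)
        rw [inv_mul_cancel₀ hx] at this
        linarith)
    rwa [fcal_sub, fcal_smul, fcal_id] at this
  rw [trR_smul_left, trR_comm σ F] at e4
  linarith

lemma traceNorm_le {A : Matrix (Fin n) (Fin n) ℂ} (hA : A.IsHermitian) (h0 : A.trace.re = 0) (c : ℝ)
    (hc : ∀ F, IsPOVMElem F → trR F A ≤ c) : traceNorm A ≤ 2 * c := by
  unfold traceNorm
  rw [dif_pos hA]
  have hF : IsPOVMElem (fcal hA (fun x => if 0 < x then 1 else 0)) := by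
    constructor
    · exact fcal_psd _ _ (by intro i; split_ifs <;> simp)
    · rw [← fcal_one hA, ← fcal_sub]
      exact fcal_psd _ _ (by intro i; split_ifs <;> simp)
  have h1 := hc _ hF
  have h2 : trR (fcal hA (fun x => if 0 < x then 1 else 0)) A
      = ∑ i, (if 0 < hA.eigenvalues i then 1 else 0) * hA.eigenvalues i := by
    unfold trR
    rw [← fcal_mul_self, fcal_trace]
  have h3 := fcal_trace hA (fun x => x)
  rw [fcal_id, h0] at h3
  rw [h2] at h1
  have : ∑ i, |hA.eigenvalues i| =
      ∑ i, (2 * ((if 0 < hA.eigenvalues i then 1 else 0) * hA.eigenvalues i)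
        - hA.eigenvalues i) := by
    apply Finset.sum_congr rfl
    intro i _
    split_ifs with hx
    · rw [abs_of_pos hx]; ring
    · rw [abs_of_nonpos (not_lt.1 hx)]; ring
  rw [this, Finset.sum_sub_distrib, ← Finset.mul_sum]
  linarith

/-- gentle measurement, one-parameter version -/
lemma gentle_aux {ρ Q F : Matrix (Fin n) (Fin n) ℂ} (hρ : IsState ρ) (hQ : Q.IsHermitian) (hQQ : Q * Q = Q)
    (hF : IsPOVMElem F) (a b : ℝ) (c : ℝ) (hc : 0 < c) (ht : trR Q ρ = c ^ 2) :
    (a ^ 2 - b ^ 2) * (trR F ρ - trR F (((c ^ 2)⁻¹ : ℝ) • (Q * ρ * Q)))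
      ≤ a ^ 2 + b ^ 2 + 2 * a * b * c := by
  have key : ∀ x y : ℝ, ((x : ℂ) • (1 : Matrix (Fin n) (Fin n) ℂ) + (y : ℂ) • Q) * ρ * ((x : ℂ) • (1 : Matrix (Fin n) (Fin n) ℂ) + (y : ℂ) • Q)ᴴ
      = ((x ^ 2 : ℝ) : ℂ) • ρ + ((x * y : ℝ) : ℂ) • (Q * ρ + ρ * Q)
        + ((y ^ 2 : ℝ) : ℂ) • (Q * ρ * Q) := by
    intro x y
    rw [Matrix.conjTranspose_add, Matrix.conjTranspose_smul, Matrix.conjTranspose_smul, hQ]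
    simp only [add_mul, mul_add, smul_mul_assoc, mul_smul_comm, one_mul, mul_one,
      Matrix.conjTranspose_one, smul_add, smul_smul, Complex.star_def, Complex.conj_ofReal]
    push_cast
    module
  have psd : ∀ x y : ℝ, (((x ^ 2 : ℝ) : ℂ) • ρ + ((x * y : ℝ) : ℂ) • (Q * ρ + ρ * Q)
        + ((y ^ 2 : ℝ) : ℂ) • (Q * ρ * Q)).PosSemidef := by
    intro x y
    rw [← key]
    exact hρ.1.mul_mul_conjTranspose_same _
  have hv := trR_nonneg hF.1 (psd b (a / c))
  have hu := trR_nonneg hF.2 (psd a (b / c))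
  have hr : trR 1 ρ = 1 := by rw [trR_one, hρ.2]; simp
  have h1 : trR 1 (Q * ρ) = c ^ 2 := by rw [← ht]; simp [trR]
  have h2 : trR 1 (ρ * Q) = c ^ 2 := by rw [← ht, trR_comm Q]; simp [trR]
  have h3 : trR 1 (Q * ρ * Q) = c ^ 2 := by
    rw [← ht]; simp only [trR, one_mul]; rw [Matrix.trace_mul_comm, ← mul_assoc, hQQ]
  have h4 : trR F (((c ^ 2)⁻¹ : ℝ) • (Q * ρ * Q)) = (c ^ 2)⁻¹ * trR F (Q * ρ * Q) := by
    rw [← trR_smul_right]; congr 1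
  simp only [trR_sub_left, trR_add_right, trR_smul_right, hr, h1, h2, h3] at hu hv
  rw [h4]
  have c0 : c ≠ 0 := hc.ne'
  generalize trR F ρ = X at *
  have hu2 : a ^ 2 * (1 - X) + a * (b / c) * (c ^ 2 - trR F (Q * ρ) + (c ^ 2 - trR F (ρ * Q)))
      + (b / c) ^ 2 * (c ^ 2 - trR F (Q * ρ * Q))
      = a ^ 2 + b ^ 2 + 2 * a * b * c - a ^ 2 * X
        - b * (a / c) * (trR F (Q * ρ) + trR F (ρ * Q))
        - b ^ 2 * ((c ^ 2)⁻¹ * trR F (Q * ρ * Q)) := by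
    field_simp
    ring
  have hv2 : (a / c) ^ 2 * trR F (Q * ρ * Q) = a ^ 2 * ((c ^ 2)⁻¹ * trR F (Q * ρ * Q)) := by
    field_simp
  rw [hu2] at hu
  rw [hv2] at hv
  linarith

lemma gentle {ρ Q F : Matrix (Fin n) (Fin n) ℂ} (hρ : IsState ρ) (hQ : Q.IsHermitian) (hQQ : Q * Q = Q)
    (hF : IsPOVMElem F) (r : ℝ) (hr : 1 < r) (c : ℝ) (hc : 0 < c) (ht : trR Q ρ = c ^ 2)
    (htr : 1 - 1 / r ≤ c ^ 2) :
    trR F (ρ - (((c ^ 2)⁻¹ : ℝ) • (Q * ρ * Q))) ≤ 1 / Real.sqrt r := by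
  rw [trR_sub_right]
  set D := trR F ρ - trR F (((c ^ 2)⁻¹ : ℝ) • (Q * ρ * Q))
  have hs : ∀ w : ℝ, 0 < w → 2 * D ≤ w * (1 - c) + (1 + c) / w := by
    intro w hw
    have hsw : 0 < Real.sqrt w := Real.sqrt_pos.2 hw
    have h := gentle_aux hρ hQ hQQ hF (Real.sqrt w + 1 / Real.sqrt w)
      (1 / Real.sqrt w - Real.sqrt w) c hc ht
    have hq : Real.sqrt w ^ 2 = w := Real.sq_sqrt hw.le
    generalize Real.sqrt w = s at *
    subst hq
    have h1 : (s + 1 / s) ^ 2 - (1 / s - s) ^ 2 = 4 := by field_simp; ring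
    have h2 : (s + 1 / s) ^ 2 + (1 / s - s) ^ 2 + 2 * (s + 1 / s) * (1 / s - s) * c
      = 2 * (s ^ 2 * (1 - c) + (1 + c) / s ^ 2) := by field_simp; ring
    rw [h1, h2] at h
    change 4 * D ≤ _ at h
    linarith
  have hr0 : 0 < Real.sqrt r := Real.sqrt_pos.2 (by linarith)
  have hrr : Real.sqrt r ^ 2 = r := Real.sq_sqrt (by linarith)
  -- choose w = (1 + c) * sqrt r
  have h := hs ((1 + c) * Real.sqrt r) (by positivity)
  have e1 : (1 + c) / ((1 + c) * Real.sqrt r) = 1 / Real.sqrt r := by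
    have : 1 + c ≠ 0 := by positivity
    field_simp
  have e2 : (1 + c) * Real.sqrt r * (1 - c) ≤ 1 / Real.sqrt r := by
    have : (1 + c) * Real.sqrt r * (1 - c) = Real.sqrt r * (1 - c ^ 2) := by ring
    rw [this]
    calc Real.sqrt r * (1 - c ^ 2) ≤ Real.sqrt r * (1 / r) := by gcongr; linarith
      _ = 1 / Real.sqrt r := by
        rw [← hrr]; simp only [Real.sqrt_sq hr0.le]; field_simp
  linarith

lemma trR_le_one {ρ F : Matrix (Fin n) (Fin n) ℂ} (hρ : IsState ρ) (hF : IsPOVMElem F) : trR F ρ ≤ 1 := by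
  have h := trR_mono_left hF.2 hρ.1
  rw [trR_one, hρ.2] at h
  simpa using h

lemma povm_bound {ρ σ : Matrix (Fin n) (Fin n) ℂ} (hρ : IsState ρ) (hσ : IsState σ) (hs : SuppLE ρ σ)
    {F : Matrix (Fin n) (Fin n) ℂ} (hF : IsPOVMElem F) (h0 : trR F σ ≠ 0) :
    trR F ρ * Real.logb 2 (trR F ρ / trR F σ) ≤ obsDiv ρ σ := by
  apply le_csSup
  · obtain ⟨C, hC, hdom⟩ := dominate hρ hσ hs
    refine ⟨|Real.logb 2 C|, ?_⟩
    rintro x ⟨G, hG, hG0, rfl⟩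
    have hp0 := trR_nonneg hG.1 hρ.1
    have hp1 := trR_le_one hρ hG
    have hq : 0 < trR G σ := lt_of_le_of_ne (trR_nonneg hG.1 hσ.1) (Ne.symm hG0)
    rcases hp0.eq_or_lt with hp | hp
    · rw [← hp]; simp
    · have h1 : Real.logb 2 (trR G ρ / trR G σ) ≤ Real.logb 2 C := by
        apply Real.logb_le_logb_of_le (by norm_num) (by positivity)
        rw [div_le_iff₀ hq]
        exact hdom G hG.1
      calc _ ≤ trR G ρ * |Real.logb 2 C| := by
            gcongr
            exact h1.trans (le_abs_self _)
        _ ≤ 1 * |Real.logb 2 C| := by gcongr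
        _ = _ := one_mul _
  · exact ⟨F, hF, h0, rfl⟩

lemma obsDiv_nonneg {ρ σ : Matrix (Fin n) (Fin n) ℂ} (hρ : IsState ρ) (hσ : IsState σ) (hs : SuppLE ρ σ) :
    0 ≤ obsDiv ρ σ := by
  have h := povm_bound hρ hσ hs (F := 1) ⟨Matrix.PosSemidef.one, by simpa using Matrix.PosSemidef.zero⟩
    (by rw [trR_one, hσ.2]; simp)
  rw [trR_one, trR_one, hρ.2, hσ.2] at h
  simpa using h

lemma exists_good {ρ σ : Matrix (Fin n) (Fin n) ℂ} (hρ : IsState ρ) (hσ : IsState σ) (hs : SuppLE ρ σ)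
    (k' : ℝ) (hk' : obsDiv ρ σ + 4 ≤ k') (r : ℝ) (hr : 1 < r)
    {M : Matrix (Fin n) (Fin n) ℂ} (hM : M.PosSemidef) (hm : 0 < trR M σ) :
    ∃ ρ' : Matrix (Fin n) (Fin n) ℂ, IsState ρ' ∧ (∀ F, IsPOVMElem F → trR F (ρ - ρ') ≤ 1 / Real.sqrt r) ∧
      trR M ρ' ≤ trR M σ * (2 : ℝ) ^ (r * k') := by
  have hk0 := obsDiv_nonneg hρ hσ hs
  set m := trR M σ with hmdef
  set T : ℝ := (2 : ℝ) ^ (r * k') with hT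
  have hT0 : 0 < T := by positivity
  set L : ℝ := m * T with hL
  have hL0 : 0 < L := by positivity
  set h := hM.1
  have hnn := hM.eigenvalues_nonneg
  set P := fcal h (fun x => if L < x then 1 else 0) with hP
  set Q := fcal h (fun x => if L < x then 0 else 1) with hQ
  have hPQ : P = 1 - Q := by
    rw [hP, hQ, ← fcal_one h, ← fcal_sub]
    congr 1; ext x; split_ifs <;> simp
  have hQp : Q.PosSemidef := fcal_psd _ _ (by intro i; split_ifs <;> simp)
  have hPp : P.PosSemidef := fcal_psd _ _ (by intro i; split_ifs <;> simp)
  have hQQ : Q * Q = Q := by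
    rw [hQ, ← fcal_mul]
    congr 1; ext x; split_ifs <;> simp
  have hPpovm : IsPOVMElem P := ⟨hPp, by rw [hPQ]; simpa using hQp⟩
  -- weight of `P` in `σ`
  have hPs : L * trR P σ ≤ m := by
    rw [← trR_smul_left]
    apply trR_mono_left _ hσ.1
    have := fcal_psd h (fun x => x - L * (if L < x then 1 else 0)) (by
      intro i
      split_ifs with hx
      · linarith
      · have := hnn i
        simpa using this)
    rwa [fcal_sub, fcal_smul, fcal_id] at this
  have hPs' : T * trR P σ ≤ 1 := by
    have : m * (T * trR P σ) ≤ m * 1 := by rw [hL] at hPs; linarith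
    exact le_of_mul_le_mul_left this hm
  -- weight of `P` in `ρ`
  have hp : trR P ρ ≤ 1 / r := by
    by_contra hcon
    push Not at hcon
    have hr0 : 0 < r := by linarith
    set p := trR P ρ with hpdef
    have hp0 : 0 < p := lt_trans (by positivity) hcon
    have hq : 0 < trR P σ := by
      obtain ⟨C, hC, hdom⟩ := dominate hρ hσ hs
      have := hdom P hPp
      by_contra hneg
      push Not at hneg
      have : C * trR P σ ≤ 0 := mul_nonpos_of_nonneg_of_nonpos hC.le hneg
      linarith
    have hb := povm_bound hρ hσ hs hPpovm hq.ne'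
    rw [← hpdef] at hb
    have h1 : Real.logb 2 (p * T) ≤ Real.logb 2 (p / trR P σ) := by
      apply Real.logb_le_logb_of_le (by norm_num) (by positivity)
      rw [le_div_iff₀ hq]
      calc p * T * trR P σ = p * (T * trR P σ) := by ring
        _ ≤ p * 1 := by gcongr
        _ = p := mul_one p
    have h2 : Real.logb 2 (p * T) = Real.logb 2 p + r * k' := by
      rw [Real.logb_mul hp0.ne' hT0.ne', hT, Real.logb_rpow (by norm_num) (by norm_num)]
    have h3 : -2 ≤ p * Real.logb 2 p := by
      have hl : 1 - p⁻¹ ≤ Real.log p := Real.one_sub_inv_le_log_of_pos hp0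
      have hl2 : -1 ≤ p * Real.log p := by
        have := mul_le_mul_of_nonneg_left hl hp0.le
        rw [mul_sub, mul_inv_cancel₀ hp0.ne'] at this
        linarith
      have hlog : (1 / 2 : ℝ) < Real.log 2 := by
        have := Real.log_two_gt_d9
        linarith
      unfold Real.logb
      rw [← mul_div_assoc, le_div_iff₀ (by linarith)]
      linarith
    have h4 : k' ≤ p * (r * k') := by
      have : 1 ≤ p * r := by
        rw [div_lt_iff₀ hr0] at hcon
        exact hcon.le
      have hk'0 : 0 ≤ k' := by linarith
      nlinarith
    have h5 : p * Real.logb 2 (p * T) ≤ obsDiv ρ σ :=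
      le_trans (mul_le_mul_of_nonneg_left h1 hp0.le) hb
    rw [h2, mul_add] at h5
    linarith
  have ht : trR Q ρ = 1 - trR P ρ := by
    rw [hPQ, trR_sub_left, trR_one, hρ.2]; simp
  have hr1 : 1 / r < 1 := by rw [div_lt_one (by linarith)]; exact hr
  have htpos : 0 < trR Q ρ := by linarith
  set c := Real.sqrt (trR Q ρ) with hc
  have hc0 : 0 < c := Real.sqrt_pos.2 htpos
  have hcc : c ^ 2 = trR Q ρ := Real.sq_sqrt htpos.le
  have hQrQ : (Q * ρ * Q).PosSemidef := by
    have := hρ.1.mul_mul_conjTranspose_same Q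
    rwa [hQp.1] at this
  have hsm : (((c ^ 2)⁻¹ : ℝ) • (Q * ρ * Q)) = ((((c ^ 2)⁻¹ : ℝ) : ℂ)) • (Q * ρ * Q) := by
    ext i j; simp
  refine ⟨((c ^ 2)⁻¹ : ℝ) • (Q * ρ * Q), ⟨?_, ?_⟩, ?_, ?_⟩
  · rw [hsm]
    apply hQrQ.smul
    have : (0 : ℝ) ≤ (c ^ 2)⁻¹ := by positivity
    exact_mod_cast this
  · have him : (Q * ρ * Q).trace = ((c ^ 2 : ℝ) : ℂ) := by
      have h1 := hQrQ.trace_nonneg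
      rw [Complex.le_def] at h1
      apply Complex.ext
      · rw [hcc, Complex.ofReal_re, Matrix.trace_mul_comm, ← mul_assoc, hQQ]; rfl
      · rw [Complex.ofReal_im, ← h1.2]; simp
    rw [hsm, Matrix.trace_smul, him, smul_eq_mul, ← Complex.ofReal_mul,
      inv_mul_cancel₀ (by positivity)]
    simp
  · intro F hF
    exact gentle hρ hQp.1 hQQ hF r hr c hc0 hcc.symm (by linarith)
  · rw [hsm, trR_smul_right]
    have e1 : trR M (Q * ρ * Q) = trR (Q * M * Q) ρ := by
      unfold trR
      rw [← mul_assoc, Matrix.trace_mul_comm, ← mul_assoc, ← mul_assoc]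
    have e2 : trR (Q * M * Q) ρ ≤ trR ((L : ℂ) • Q) ρ := by
      apply trR_mono_left _ hρ.1
      have := fcal_psd h (fun x => L * (if L < x then 0 else 1) -
          (((if L < x then 0 else 1) * x) * (if L < x then 0 else 1))) (by
        intro i
        split_ifs with hx
        · simp
        · simpa using hx)
      rw [fcal_sub, fcal_smul, fcal_mul, fcal_mul_self] at this
      exact this
    rw [trR_smul_left] at e2
    rw [e1, hcc]
    calc (trR Q ρ)⁻¹ * trR (Q * M * Q) ρ ≤ (trR Q ρ)⁻¹ * (L * trR Q ρ) := by gcongr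
      _ = L := by field_simp

/-- the convex set of nearby states -/
def nearSet (ρ : Matrix (Fin n) (Fin n) ℂ) (d : ℝ) : Set (Matrix (Fin n) (Fin n) ℂ) :=
  {X | IsState X ∧ ∀ F, IsPOVMElem F → trR F (ρ - X) ≤ d}

lemma psd_smul_real {A : Matrix (Fin n) (Fin n) ℂ} (hA : A.PosSemidef) {a : ℝ} (ha : 0 ≤ a) : (a • A).PosSemidef := by
  have : a • A = (a : ℂ) • A := by ext i j; simp
  rw [this]
  apply hA.smul
  exact_mod_cast ha

lemma psd_convex : Convex ℝ {X : Matrix (Fin n) (Fin n) ℂ | X.PosSemidef} := by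
  intro X hX Y hY a b ha hb _
  exact (psd_smul_real hX ha).add (psd_smul_real hY hb)

lemma psd_closed : IsClosed {X : Matrix (Fin n) (Fin n) ℂ | X.PosSemidef} := by
  simp only [Matrix.posSemidef_iff_dotProduct_mulVec, Matrix.IsHermitian, Set.ofPred_and,
    Set.ofPred_forall]
  apply IsClosed.inter
  · exact isClosed_eq (by fun_prop) (by fun_prop)
  · apply isClosed_iInter
    intro v
    exact isClosed_le (by fun_prop) (by fun_prop)

lemma trR_smul_real (F A : Matrix (Fin n) (Fin n) ℂ) (c : ℝ) : trR F (c • A) = c * trR F A := by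
  simp [trR]

lemma nearSet_convex (ρ : Matrix (Fin n) (Fin n) ℂ) (d : ℝ) : Convex ℝ (nearSet ρ d) := by
  rintro X ⟨hX, hX2⟩ Y ⟨hY, hY2⟩ a b ha hb hab
  refine ⟨⟨psd_convex hX.1 hY.1 ha hb hab, ?_⟩, ?_⟩
  · rw [Matrix.trace_add, Matrix.trace_smul, Matrix.trace_smul, hX.2, hY.2]
    simp only [Complex.real_smul, mul_one]
    exact_mod_cast hab
  · intro F hF
    have h1 := hX2 F hF
    have h2 := hY2 F hF
    have e : ρ - (a • X + b • Y) = a • (ρ - X) + b • (ρ - Y) := by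
      have : ρ = (a + b) • ρ := by rw [hab, one_smul]
      conv_lhs => rw [this]
      module
    rw [e, trR_add_right, trR_smul_real, trR_smul_real]
    calc _ ≤ a * d + b * d := by gcongr
      _ = d := by rw [← add_mul, hab, one_mul]

lemma nearSet_closed (ρ : Matrix (Fin n) (Fin n) ℂ) (d : ℝ) : IsClosed (nearSet ρ d) := by
  unfold nearSet IsState
  simp only [Set.ofPred_and, Set.ofPred_forall]
  refine (psd_closed.inter (isClosed_eq (by fun_prop) (by fun_prop))).inter ?_
  apply isClosed_iInter
  intro F
  apply isClosed_iInter
  intro _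
  unfold trR
  exact isClosed_le (by fun_prop) (by fun_prop)

lemma state_entry {X : Matrix (Fin n) (Fin n) ℂ} (hX : IsState X) (i j : Fin n) : ‖X i j‖ ≤ 1 := by
  have hsum : ∑ l, hX.1.1.eigenvalues l = 1 := by
    have h1 := fcal_trace hX.1.1 (fun x => x)
    rw [fcal_id] at h1
    have h2 : X.trace.re = 1 := by rw [hX.2]; simp
    linarith
  have e : X i j = ∑ l, (hX.1.1.eigenvectorUnitary : Matrix (Fin n) (Fin n) ℂ) i l * (hX.1.1.eigenvalues l : ℂ) *
      star ((hX.1.1.eigenvectorUnitary : Matrix (Fin n) (Fin n) ℂ) j l) := by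
    have := congrFun (congrFun (fcal_id hX.1.1) i) j
    rw [← this]
    unfold fcal
    rw [Matrix.mul_apply]
    simp [Matrix.mul_diagonal, Matrix.star_apply]
  rw [e, ← hsum]
  refine (norm_sum_le _ _).trans (Finset.sum_le_sum fun l _ => ?_)
  have hu := fun a => entry_norm_bound_of_unitary hX.1.1.eigenvectorUnitary.2 a l
  have hl := hX.1.eigenvalues_nonneg l
  rw [norm_mul, norm_mul, norm_star, Complex.norm_real, Real.norm_of_nonneg hl]
  calc _ ≤ 1 * hX.1.1.eigenvalues l * 1 := by
        gcongr
        · exact hu i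
        · exact hu j
    _ = _ := by ring

lemma nearSet_compact (ρ : Matrix (Fin n) (Fin n) ℂ) (d : ℝ) : IsCompact (nearSet ρ d) := by
  have hc : IsCompact (Set.pi Set.univ (fun _ : Fin n => Set.pi Set.univ
      (fun _ : Fin n => Metric.closedBall (0 : ℂ) 1))) :=
    isCompact_univ_pi fun _ => isCompact_univ_pi fun _ => isCompact_closedBall _ _
  refine IsCompact.of_isClosed_subset (X := Matrix (Fin n) (Fin n) ℂ) hc (nearSet_closed ρ d) ?_
  intro X hX i _ j _
  simpa using state_entry hX.1 i j

/-- real-linear functionals on matrices are trace pairings -/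
lemma functional_repr (f : Matrix (Fin n) (Fin n) ℂ →ₗ[ℝ] ℝ) : ∃ N : Matrix (Fin n) (Fin n) ℂ, ∀ X, f X = trR N X := by
  refine ⟨Matrix.of fun j i => (f (Matrix.single i j 1) : ℂ) -
    Complex.I * (f (Matrix.single i j Complex.I) : ℂ), fun X => ?_⟩
  conv_lhs => rw [Matrix.matrix_eq_sum_single X]
  have hs : ∀ i j, Matrix.single i j (X i j) = (X i j).re • (Matrix.single i j 1 : Matrix (Fin n) (Fin n) ℂ) +
      (X i j).im • (Matrix.single i j Complex.I : Matrix (Fin n) (Fin n) ℂ) := by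
    intro i j
    rw [Matrix.smul_single, Matrix.smul_single, ← Matrix.single_add]
    congr 1
    apply Complex.ext <;> simp
  simp only [hs, map_sum, map_add, map_smul]
  unfold trR
  rw [Matrix.trace_mul_comm]
  simp only [Matrix.trace, Matrix.diag, Matrix.mul_apply, Complex.re_sum, Matrix.of_apply]
  refine Finset.sum_congr rfl fun i _ => Finset.sum_congr rfl fun j _ => ?_
  simp

lemma trR_conjTranspose (N X : Matrix (Fin n) (Fin n) ℂ) (hX : X.IsHermitian) : trR Nᴴ X = trR N X := by
  unfold trR
  have : (Nᴴ * X).trace = star ((N * X).trace) := by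
    rw [← Matrix.trace_conjTranspose, Matrix.conjTranspose_mul, hX, Matrix.trace_mul_comm]
  rw [this]; simp

lemma functional_psd (f : Matrix (Fin n) (Fin n) ℂ →ₗ[ℝ] ℝ) (hf : ∀ X : Matrix (Fin n) (Fin n) ℂ, X.PosSemidef → 0 ≤ f X) :
    ∃ M : Matrix (Fin n) (Fin n) ℂ, M.PosSemidef ∧ ∀ X : Matrix (Fin n) (Fin n) ℂ, X.IsHermitian → f X = trR M X := by
  obtain ⟨N, hN⟩ := functional_repr f
  set M : Matrix (Fin n) (Fin n) ℂ := ((1 / 2 : ℝ) : ℂ) • (Nᴴ + N) with hMd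
  have hM : ∀ X : Matrix (Fin n) (Fin n) ℂ, X.IsHermitian → f X = trR M X := by
    intro X hX
    rw [hN, hMd, trR_smul_left]
    have : trR (Nᴴ + N) X = trR Nᴴ X + trR N X := by simp [trR, add_mul]
    rw [this, trR_conjTranspose N X hX]
    ring
  have hMH : M.IsHermitian := by
    rw [hMd]
    unfold Matrix.IsHermitian
    rw [Matrix.conjTranspose_smul, Matrix.conjTranspose_add, Matrix.conjTranspose_conjTranspose,
      add_comm]
    simp
  refine ⟨M, ?_, hM⟩
  apply Matrix.PosSemidef.of_dotProduct_mulVec_nonneg hMH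
  intro v
  have hv : (Matrix.vecMulVec v (star v)).PosSemidef := Matrix.posSemidef_vecMulVec_self_star v
  have h1 := hf _ hv
  rw [hM _ hv.1] at h1
  have e : (M * Matrix.vecMulVec v (star v)).trace = star v ⬝ᵥ (M *ᵥ v) := by
    rw [Matrix.mul_vecMulVec, Matrix.trace_vecMulVec, dotProduct_comm]
  unfold trR at h1
  rw [e] at h1
  rw [Complex.le_def]
  refine ⟨by simpa using h1, ?_⟩
  have := hMH.im_star_dotProduct_mulVec_self v
  simpa using this.symm

end Helpers

/-- Weak quantum substate property from observational divergence. -/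
theorem weak_substate_from_obsDiv {n : ℕ} (ρ σ : Matrix (Fin n) (Fin n) ℂ)
    (hρ : IsState ρ) (hσ : IsState σ) (hsupp : SuppLE ρ σ)
    (k : ℝ) (hk : k = obsDiv ρ σ)
    (k' : ℝ) (hk' : k' = k + 4 * Real.sqrt (k + 1) + 2 * Real.logb 2 (k + 1) + 4)
    (r : ℝ) (hr : 1 ≤ r) :
    ∃ ρ' : Matrix (Fin n) (Fin n) ℂ, IsState ρ' ∧
      traceNorm (ρ - ρ') ≤ 2 / Real.sqrt r ∧
      (σ - (((r - 1) / (r * (2 : ℝ) ^ (r * k')) : ℝ) : ℂ) • ρ').PosSemidef := by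
  have hr0 : 0 < r := by linarith
  subst hk
  have hk0 := obsDiv_nonneg hρ hσ hsupp
  have hk4 : obsDiv ρ σ + 4 ≤ k' := by
    have h1 := Real.sqrt_nonneg (obsDiv ρ σ + 1)
    have h2 : 0 ≤ Real.logb 2 (obsDiv ρ σ + 1) := Real.logb_nonneg (by norm_num) (by linarith)
    linarith
  set μ : ℝ := (r - 1) / (r * (2 : ℝ) ^ (r * k')) with hμ
  have hT0 : (0 : ℝ) < (2 : ℝ) ^ (r * k') := by positivity
  have hμ0 : 0 ≤ μ := div_nonneg (by linarith) (by positivity)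
  suffices hmain : ∃ ρ' ∈ nearSet ρ (1 / Real.sqrt r), (σ - (μ : ℂ) • ρ').PosSemidef by
    obtain ⟨ρ', ⟨hs, hn⟩, hp⟩ := hmain
    refine ⟨ρ', hs, ?_, hp⟩
    have := traceNorm_le (hρ.1.1.sub hs.1.1) (by rw [Matrix.trace_sub, hρ.2, hs.2]; simp) _ hn
    calc _ ≤ _ := this
      _ = _ := by ring
  have hself : ρ ∈ nearSet ρ (1 / Real.sqrt r) := by
    refine ⟨hρ, fun F _ => ?_⟩
    have : trR F (ρ - ρ) = 0 := by simp [trR]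
    rw [this]
    positivity
  rcases hr.eq_or_lt with h1 | h1
  · refine ⟨ρ, hself, ?_⟩
    have : μ = 0 := by rw [hμ, ← h1]; simp
    rw [this]
    simpa using hσ.1
  by_contra hcon
  push Not at hcon
  set A : Set (Matrix (Fin n) (Fin n) ℂ) :=
    (fun X => σ - μ • X) '' nearSet ρ (1 / Real.sqrt r) with hA
  have hsmul : ∀ X : Matrix (Fin n) (Fin n) ℂ, μ • X = (μ : ℂ) • X := by
    intro X; ext i j; simp
  have hAc : IsCompact A := (nearSet_compact ρ _).image (by fun_prop)
  have hAconv : Convex ℝ A := by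
    rintro _ ⟨X, hX, rfl⟩ _ ⟨Y, hY, rfl⟩ a b ha hb hab
    refine ⟨a • X + b • Y, nearSet_convex _ _ hX hY ha hb hab, ?_⟩
    have : σ = (a + b) • σ := by rw [hab, one_smul]
    dsimp only
    conv_lhs => rw [this]
    module
  have hdisj : Disjoint A {X | X.PosSemidef} := by
    rw [Set.disjoint_left]
    rintro _ ⟨X, hX, rfl⟩ hpsd
    apply hcon X hX
    rw [← hsmul]
    exact hpsd
  have : LocallyConvexSpace ℝ (Matrix (Fin n) (Fin n) ℂ) :=
    inferInstanceAs (LocallyConvexSpace ℝ (Fin n → Fin n → ℂ))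
  obtain ⟨f, u, v, hfA, huv, hfB⟩ :=
    geometric_hahn_banach_compact_closed hAconv hAc psd_convex psd_closed hdisj
  have hv0 : v < 0 := by simpa using hfB 0 Matrix.PosSemidef.zero
  have hfpos : ∀ X : Matrix (Fin n) (Fin n) ℂ, X.PosSemidef → 0 ≤ f.toLinearMap X := by
    intro X hX
    by_contra hneg
    push Not at hneg
    have hneg' : f X < 0 := hneg
    have h2 := hfB ((v / f X) • X) (psd_smul_real hX (div_nonneg_of_nonpos hv0.le hneg'.le))
    rw [map_smul, smul_eq_mul, div_mul_cancel₀ _ hneg'.ne] at h2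
    exact lt_irrefl _ h2
  obtain ⟨M, hM, hMf⟩ := functional_psd f.toLinearMap hfpos
  have hlt : ∀ X ∈ nearSet ρ (1 / Real.sqrt r), trR M σ < μ * trR M X := by
    intro X hX
    have h2 := hfA _ ⟨X, hX, rfl⟩
    have hH : (σ - μ • X).IsHermitian := hσ.1.1.sub (psd_smul_real hX.1.1 hμ0).1
    have h3 := hMf _ hH
    rw [trR_sub_right, trR_smul_real] at h3
    have h4 : f (σ - μ • X) = trR M σ - μ * trR M X := h3
    simp only at h2
    linarith
  have hm0 := trR_nonneg hM hσ.1
  rcases hm0.eq_or_lt with hm | hm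
  · obtain ⟨C, hC, hdom⟩ := dominate hρ hσ hsupp
    have h2 := hdom M hM
    rw [← hm, mul_zero] at h2
    have h3 := hlt ρ hself
    rw [← hm] at h3
    have := mul_nonpos_of_nonneg_of_nonpos hμ0 h2
    linarith
  · obtain ⟨ρ', hs, hn, hle⟩ := exists_good hρ hσ hsupp k' hk4 r h1 hM hm
    have h2 := hlt ρ' ⟨hs, hn⟩
    have h3 : μ * trR M ρ' ≤ μ * (trR M σ * (2 : ℝ) ^ (r * k')) :=
      mul_le_mul_of_nonneg_left hle hμ0
    have h4 : μ * (trR M σ * (2 : ℝ) ^ (r * k')) = trR M σ * ((r - 1) / r) := by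
      rw [hμ]; field_simp
    have h5 : (r - 1) / r < 1 := by rw [div_lt_one hr0]; linarith
    have h6 : trR M σ * ((r - 1) / r) < trR M σ * 1 := mul_lt_mul_of_pos_left h5 hm
    linarith

end
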